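/- arXiv:0910.5512 — 3 statements merged into one kernel-verified Lean document; each statement's English description precedes it below -/
import Mathlib

section
/- Let $p > 1$, $a, b \ge 0$ and $n \ge 0$ be real numbers. Suppose $z : [0,\infty) \to [0,\infty)$ is differentiable and satisfies the differential inequality $z'(t) \le \frac{a}{(1+t)^p} z(t) + b(1+t)^n$ for all $t \ge 0$. Then for all $t \ge 0$, $z(t) \le e^{a/(p-1)} \left( z(0) + \frac{b}{n+1} \right) (1+t)^{n+1}$. -/
theorem hasDerivAt_one_add_rpow (q : ℝ) {t : ℝ} (ht : 0 ≤ t) :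
    HasDerivAt (fun s : ℝ => (1 + s) ^ q) (q * (1 + t) ^ (q - 1)) t := by
  have h := ((hasDerivAt_id t).const_add 1).rpow_const (p := q) (Or.inl (by simp; linarith))
  simpa using h

theorem hasDerivAt_exp_one_add_rpow {p : ℝ} (hp : 1 < p) (a : ℝ) {t : ℝ} (ht : 0 ≤ t) :
    HasDerivAt (fun s : ℝ => Real.exp (a / (p - 1) * (1 + s) ^ (1 - p)))
      (-(Real.exp (a / (p - 1) * (1 + t) ^ (1 - p)) * (a / (1 + t) ^ p))) t := by
  convert ((hasDerivAt_one_add_rpow (1 - p) ht).const_mul (a / (p - 1))).exp using 1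
  have hp' : p - 1 ≠ 0 := by linarith
  rw [show 1 - p - 1 = -p by ring, Real.rpow_neg (by linarith)]
  field_simp
  ring


/-- Gronwall-type estimate: if `z' ≤ a/(1+t)^p · z + b(1+t)^n` with `p > 1`, then
`z(t) ≤ e^{a/(p-1)} (z(0) + b/(n+1)) (1+t)^{n+1}`. -/
theorem stmt0 (p a b n : ℝ) (hp : 1 < p) (ha : 0 ≤ a) (hb : 0 ≤ b) (hn : 0 ≤ n)
    (z : ℝ → ℝ)
    (hz_nonneg : ∀ t : ℝ, 0 ≤ t → 0 ≤ z t)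
    (hz_diff : ∀ t : ℝ, 0 ≤ t → DifferentiableAt ℝ z t)
    (hz_ineq : ∀ t : ℝ, 0 ≤ t →
      deriv z t ≤ a / (1 + t) ^ p * z t + b * (1 + t) ^ n) :
    ∀ t : ℝ, 0 ≤ t →
      z t ≤ Real.exp (a / (p - 1)) * (z 0 + b / (n + 1)) * (1 + t) ^ (n + 1) := by
  have hn1 : 0 < n + 1 := by linarith
  have hc : 0 ≤ a / (p - 1) := div_nonneg ha (by linarith)
  set E : ℝ → ℝ := fun s => Real.exp (a / (p - 1) * (1 + s) ^ (1 - p))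
  have hE_deriv : ∀ s, 0 ≤ s → HasDerivAt E (-(E s * (a / (1 + s) ^ p))) s :=
    fun s hs => hasDerivAt_exp_one_add_rpow hp a hs
  have hE_le : ∀ s, 0 ≤ s → E s ≤ Real.exp (a / (p - 1)) := fun s hs =>
    Real.exp_le_exp.2 (mul_le_of_le_one_right hc
      (Real.rpow_le_one_of_one_le_of_nonpos (by linarith) (by linarith)))
  have hE_ge : ∀ s, 0 ≤ s → 1 ≤ E s := fun s hs =>
    Real.one_le_exp (mul_nonneg hc (Real.rpow_nonneg (by linarith) _))
  have hf : ∀ s, 0 ≤ s →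
      HasDerivAt (fun s => E s * z s) (-(E s * (a / (1 + s) ^ p)) * z s + E s * deriv z s) s :=
    fun s hs => (hE_deriv s hs).mul (hz_diff s hs).hasDerivAt
  have hB : ∀ s, 0 ≤ s →
      HasDerivAt (fun s => Real.exp (a / (p - 1)) * (z 0 + b / (n + 1) * (1 + s) ^ (n + 1)))
        (Real.exp (a / (p - 1)) * (b * (1 + s) ^ n)) s := by
    intro s hs
    refine ((((hasDerivAt_one_add_rpow (n + 1) hs).const_mul (b / (n + 1))).const_add
      (z 0)).const_mul (Real.exp (a / (p - 1)))).congr_deriv ?_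
    rw [add_sub_cancel_right]
    field_simp
  intro t ht
  have hpow : 1 ≤ (1 + t) ^ (n + 1) := Real.one_le_rpow (by linarith) hn1.le
  have hmain : E t * z t ≤ Real.exp (a / (p - 1)) * (z 0 + b / (n + 1) * (1 + t) ^ (n + 1)) := by
    refine image_le_of_deriv_right_le_deriv_boundary
      (fun s hs => (hf s hs.1).continuousAt.continuousWithinAt)
      (fun s hs => (hf s hs.1).hasDerivWithinAt) ?_
      (fun s hs => (hB s hs.1).continuousAt.continuousWithinAt)
      (fun s hs => (hB s hs.1).hasDerivWithinAt) ?_ (Set.right_mem_Icc.2 ht)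
    · exact mul_le_mul (hE_le 0 le_rfl) (by simp; positivity) (hz_nonneg 0 le_rfl)
        (Real.exp_pos _).le
    · intro s hs
      have hs1 : 0 ≤ 1 + s := by linarith [hs.1]
      calc -(E s * (a / (1 + s) ^ p)) * z s + E s * deriv z s
          = E s * (deriv z s - a / (1 + s) ^ p * z s) := by ring
        _ ≤ E s * (b * (1 + s) ^ n) :=
          mul_le_mul_of_nonneg_left (by linarith [hz_ineq s hs.1]) (Real.exp_pos _).le
        _ ≤ Real.exp (a / (p - 1)) * (b * (1 + s) ^ n) :=
          mul_le_mul_of_nonneg_right (hE_le s hs.1) (by positivity)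
  calc z t ≤ E t * z t := le_mul_of_one_le_left (hz_nonneg t ht) (hE_ge t ht)
    _ ≤ Real.exp (a / (p - 1)) * (z 0 + b / (n + 1) * (1 + t) ^ (n + 1)) := hmain
    _ ≤ Real.exp (a / (p - 1)) * ((z 0 + b / (n + 1)) * (1 + t) ^ (n + 1)) := by
      rw [add_mul]
      gcongr
      exact le_mul_of_one_le_right (hz_nonneg 0 le_rfl) hpow
    _ = Real.exp (a / (p - 1)) * (z 0 + b / (n + 1)) * (1 + t) ^ (n + 1) := by ring
end

section
/- Let $t \in \mathbb{R}$, $T_0 > 0$ and $K \ge 0$ with $K T_0 \le \tfrac{1}{4}$. Let $Y : [t - T_0, t] \to M_3(\mathbb{R})$ be a twice continuously differentiable matrix-valued function with $Y(t) = 0$, $Y'(t) = I$, and suppose every entry of $Y''(s)$ satisfies $|Y''(s)_{ij}| \le K$ for all $s \in [t - T_0, t]$. Then for every $\tau \in [t - T_0, t]$: every entry satisfies $|Y(\tau)_{ij}| \le 2(t - \tau)$, and $\tfrac{1}{2}(t-\tau)^3 \le |\det Y(\tau)| \le 2(t-\tau)^3$. -/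
/-- A function vanishing at the right endpoint of an interval is bounded by any majorant
vanishing there whose rate of decrease dominates its derivative. -/
theorem abs_le_of_abs_deriv_le_of_right_eq_zero {a b : ℝ} {f f' B B' : ℝ → ℝ}
    (hf : ∀ s ∈ Set.Icc a b, HasDerivWithinAt f (f' s) (Set.Icc a b) s)
    (hB : ∀ s, HasDerivAt B (-B' s) s) (hfb : f b = 0) (hBb : B b = 0)
    (hle : ∀ s ∈ Set.Icc a b, |f' s| ≤ B' s) {s : ℝ} (hs : s ∈ Set.Icc a b) :
    |f s| ≤ B s := by
  have hb : b ∈ Set.Icc a b := ⟨hs.1.trans hs.2, le_rfl⟩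
  have hsub : AntitoneOn (fun r => B r - f r) (Set.Icc a b) := by
    have hd : ∀ r ∈ Set.Icc a b,
        HasDerivWithinAt (fun r => B r - f r) (-B' r - f' r) (Set.Icc a b) r :=
      fun r hr => (hB r).hasDerivWithinAt.sub (hf r hr)
    refine antitoneOn_of_hasDerivWithinAt_nonpos (convex_Icc a b)
      (fun r hr => (hd r hr).continuousWithinAt)
      (fun r hr => (hd r (interior_subset hr)).mono interior_subset) fun r hr => ?_
    linarith [(abs_le.mp (hle r (interior_subset hr))).1]
  have hadd : AntitoneOn (fun r => B r + f r) (Set.Icc a b) := by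
    have hd : ∀ r ∈ Set.Icc a b,
        HasDerivWithinAt (fun r => B r + f r) (-B' r + f' r) (Set.Icc a b) r :=
      fun r hr => (hB r).hasDerivWithinAt.add (hf r hr)
    refine antitoneOn_of_hasDerivWithinAt_nonpos (convex_Icc a b)
      (fun r hr => (hd r hr).continuousWithinAt)
      (fun r hr => (hd r (interior_subset hr)).mono interior_subset) fun r hr => ?_
    linarith [(abs_le.mp (hle r (interior_subset hr))).2]
  have h₁ : B b - f b ≤ B s - f s := hsub hs hb hs.2
  have h₂ : B b + f b ≤ B s + f s := hadd hs hb hs.2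
  rw [abs_le]
  constructor <;> linarith

/-- A `3 × 3` matrix that is entrywise `1/8`-close to the identity has determinant in
`[1/2, 2]`. -/
theorem det_mem_Icc_of_abs_sub_one_le (A : Matrix (Fin 3) (Fin 3) ℝ)
    (hA : ∀ i j, |A i j - (1 : Matrix (Fin 3) (Fin 3) ℝ) i j| ≤ 1 / 8) :
    A.det ∈ Set.Icc (1 / 2 : ℝ) 2 := by
  have hdiag : ∀ i, 7 / 8 ≤ A i i ∧ A i i ≤ 9 / 8 := fun i => by
    have h := abs_le.mp (hA i i)
    rw [Matrix.one_apply_eq] at h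
    constructor <;> linarith
  have hoff : ∀ i j, i ≠ j → |A i j| ≤ 1 / 8 := fun i j hij => by
    simpa [Matrix.one_apply_ne hij] using hA i j
  have hprod : ∀ {x y z p q r : ℝ}, |x| ≤ p → |y| ≤ q → |z| ≤ r → |x * y * z| ≤ p * q * r := by
    intro x y z p q r hx hy hz
    have hp := (abs_nonneg x).trans hx
    have hq := (abs_nonneg y).trans hy
    rw [abs_mul, abs_mul]
    gcongr
  have habs : ∀ i, |A i i| ≤ 9 / 8 := fun i =>
    abs_le.mpr ⟨by linarith [(hdiag i).1], (hdiag i).2⟩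
  have h₁ := abs_le.mp (hprod (habs 0) (hoff 1 2 (by decide)) (hoff 2 1 (by decide)))
  have h₂ := abs_le.mp (hprod (hoff 0 1 (by decide)) (hoff 1 0 (by decide)) (habs 2))
  have h₃ := abs_le.mp (hprod (hoff 0 1 (by decide)) (hoff 1 2 (by decide))
    (hoff 2 0 (by decide)))
  have h₄ := abs_le.mp (hprod (hoff 0 2 (by decide)) (hoff 1 0 (by decide))
    (hoff 2 1 (by decide)))
  have h₅ := abs_le.mp (hprod (hoff 0 2 (by decide)) (habs 1) (hoff 2 0 (by decide)))
  have hupper := (abs_le.mp (hprod (habs 0) (habs 1) (habs 2))).2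
  have hlower : (7 / 8 : ℝ) * (7 / 8) * (7 / 8) ≤ A 0 0 * A 1 1 * A 2 2 := by
    have h0 := (hdiag 0).1
    have h1 := (hdiag 1).1
    have h2 := (hdiag 2).1
    gcongr
  rw [Matrix.det_fin_three]
  constructor <;> linarith


/-- Jacobian estimates for the velocity derivative of the characteristic flow: if
`Y(t) = 0`, `Y'(t) = I` and `|Y''| ≤ K` entrywise on `[t - T₀, t]` with `K T₀ ≤ 1/4`,
then on this interval `|Y(τ)ᵢⱼ| ≤ 2(t-τ)` and `½(t-τ)³ ≤ |det Y(τ)| ≤ 2(t-τ)³`. -/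
theorem stmt11 (t T₀ K : ℝ) (hT₀ : 0 < T₀) (hK : 0 ≤ K) (hKT : K * T₀ ≤ 1/4)
    (Y Y' Y'' : ℝ → Matrix (Fin 3) (Fin 3) ℝ)
    (hY : ∀ i j : Fin 3, ∀ s ∈ Set.Icc (t - T₀) t,
      HasDerivWithinAt (fun r => Y r i j) (Y' s i j) (Set.Icc (t - T₀) t) s)
    (hY' : ∀ i j : Fin 3, ∀ s ∈ Set.Icc (t - T₀) t,
      HasDerivWithinAt (fun r => Y' r i j) (Y'' s i j) (Set.Icc (t - T₀) t) s)
    (hY''cont : ∀ i j : Fin 3, ContinuousOn (fun s => Y'' s i j) (Set.Icc (t - T₀) t))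
    (hYt : Y t = 0) (hY't : Y' t = 1)
    (hY''bd : ∀ i j : Fin 3, ∀ s ∈ Set.Icc (t - T₀) t, |Y'' s i j| ≤ K) :
    ∀ τ ∈ Set.Icc (t - T₀) t,
      (∀ i j : Fin 3, |Y τ i j| ≤ 2 * (t - τ)) ∧
      (1/2) * (t - τ) ^ 3 ≤ |(Y τ).det| ∧ |(Y τ).det| ≤ 2 * (t - τ) ^ 3 := by
  intro τ hτ
  have hh : 0 ≤ t - τ := by linarith [hτ.2]
  have hKh : K * (t - τ) ≤ 1 / 4 :=
    (mul_le_mul_of_nonneg_left (by linarith [hτ.1]) hK).trans hKT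
  have hfirst : ∀ i j, ∀ s ∈ Set.Icc (t - T₀) t,
      |Y' s i j - (1 : Matrix (Fin 3) (Fin 3) ℝ) i j| ≤ K * (t - s) := fun i j s hs =>
    abs_le_of_abs_deriv_le_of_right_eq_zero (B := fun s => K * (t - s)) (B' := fun _ => K)
      (fun r hr => (hY' i j r hr).sub_const _)
      (fun r => by simpa using ((hasDerivAt_id r).const_sub t).const_mul K)
      (by simp [hY't]) (by simp) (hY''bd i j) hs
  have htaylor : ∀ i j, |Y τ i j - (τ - t) * (1 : Matrix (Fin 3) (Fin 3) ℝ) i j| ≤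
      K * (t - τ) ^ 2 / 2 := fun i j =>
    abs_le_of_abs_deriv_le_of_right_eq_zero
      (f := fun s => Y s i j - (s - t) * (1 : Matrix (Fin 3) (Fin 3) ℝ) i j)
      (B := fun s => K * (t - s) ^ 2 / 2) (B' := fun s => K * (t - s))
      (fun r hr => (hY i j r hr).sub (by
        simpa using (((hasDerivAt_id r).sub_const t).mul_const
          ((1 : Matrix (Fin 3) (Fin 3) ℝ) i j)).hasDerivWithinAt))
      (fun r => by
        refine (((((hasDerivAt_id r).const_sub t).pow 2).const_mul K).div_const 2).congr_deriv ?_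
        simp
        ring)
      (by simp [hYt]) (by simp) (hfirst i j) hτ
  rcases hh.eq_or_lt with h0 | hpos
  · obtain rfl : τ = t := by linarith
    simp [hYt]
  set A : Matrix (Fin 3) (Fin 3) ℝ := (τ - t)⁻¹ • Y τ with hAdef
  have hne : τ - t ≠ 0 := by linarith
  have hYA : Y τ = (τ - t) • A := by rw [hAdef, smul_inv_smul₀ hne]
  have hA : ∀ i j, |A i j - (1 : Matrix (Fin 3) (Fin 3) ℝ) i j| ≤ 1 / 8 := fun i j => by
    have h := htaylor i j
    rw [hYA, Matrix.smul_apply, smul_eq_mul, ← mul_sub, abs_mul, abs_sub_comm τ t,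
      abs_of_pos hpos] at h
    refine le_of_mul_le_mul_left (h.trans ?_) hpos
    nlinarith
  obtain ⟨hdet₁, hdet₂⟩ := det_mem_Icc_of_abs_sub_one_le A hA
  have hdet : |(Y τ).det| = (t - τ) ^ 3 * A.det := by
    rw [hYA, Matrix.det_smul, Fintype.card_fin, abs_mul, abs_pow, abs_sub_comm, abs_of_pos hpos,
      abs_of_pos (by linarith : 0 < A.det)]
  have hcube : 0 ≤ (t - τ) ^ 3 := by positivity
  refine ⟨fun i j => ?_, ?_, ?_⟩
  · have hone : |(1 : Matrix (Fin 3) (Fin 3) ℝ) i j| ≤ 1 := by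
      rw [Matrix.one_apply]
      split_ifs <;> simp
    have hAij : |A i j| ≤ 2 := by
      have := abs_sub_abs_le_abs_sub (A i j) ((1 : Matrix (Fin 3) (Fin 3) ℝ) i j)
      linarith [hA i j]
    rw [hYA, Matrix.smul_apply, smul_eq_mul, abs_mul, abs_sub_comm, abs_of_pos hpos, mul_comm]
    gcongr
  · rw [hdet, mul_comm]
    gcongr
  · rw [hdet, mul_comm]
    gcongr
end

section
/- Let $t \in \mathbb{R}$, $T_0 > 0$ and $K \ge 0$ with $K T_0^2 \le \tfrac{1}{4}$. Let $Z : [t - T_0, t] \to M_3(\mathbb{R})$ be a twice continuously differentiable matrix-valued function with $Z(t) = I$, $Z'(t) = 0$, and suppose every entry of $Z''(s)$ satisfies $|Z''(s)_{ij}| \le K$ for all $s \in [t - T_0, t]$. Then for every $\tau \in [t - T_0, t]$, $\tfrac{1}{2} \le |\det Z(\tau)| \le 2$. -/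
/-- Second-order Taylor estimate at the right endpoint of an interval, for a function whose
derivative vanishes there. -/
theorem abs_sub_le_of_second_deriv_bound {a t K : ℝ} {f f' f'' : ℝ → ℝ}
    (hf : ∀ s ∈ Set.Icc a t, HasDerivWithinAt f (f' s) (Set.Icc a t) s)
    (hf' : ∀ s ∈ Set.Icc a t, HasDerivWithinAt f' (f'' s) (Set.Icc a t) s)
    (hft : f' t = 0) (hbd : ∀ s ∈ Set.Icc a t, |f'' s| ≤ K) {τ : ℝ} (hτ : τ ∈ Set.Icc a t) :
    |f τ - f t| ≤ K * (t - τ) ^ 2 / 2 := by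
  have ht : t ∈ Set.Icc a t := ⟨hτ.1.trans hτ.2, le_rfl⟩
  have hd : ∀ s ∈ Set.Icc a t, |f' s| ≤ K * (t - s) := fun s hs ↦ by
    have h := (convex_Icc a t).norm_image_sub_le_of_norm_hasDerivWithin_le hf' hbd ht hs
    rwa [hft, sub_zero, Real.norm_eq_abs, Real.norm_eq_abs, abs_sub_comm s t,
      abs_of_nonneg (sub_nonneg.2 hs.2)] at h
  have hq : ∀ s, HasDerivWithinAt (fun r ↦ K * (t - r) ^ 2 / 2) (-(K * (t - s)))
      (Set.Icc a t) s := fun s ↦ by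
    have h := ((((hasDerivAt_id s).const_sub t).pow 2).const_mul K).div_const 2
    exact (h.congr_deriv (by simp; ring)).hasDerivWithinAt
  have hmono : MonotoneOn (fun r ↦ f r - K * (t - r) ^ 2 / 2) (Set.Icc a t) :=
    monotoneOn_of_hasDerivWithinAt_nonneg (convex_Icc a t)
      (fun s hs ↦ ((hf s hs).sub (hq s)).continuousWithinAt)
      (fun s hs ↦ ((hf s (interior_subset hs)).sub (hq s)).mono interior_subset)
      (fun s hs ↦ by linarith [(abs_le.1 (hd s (interior_subset hs))).1])
  have hanti : AntitoneOn (fun r ↦ f r + K * (t - r) ^ 2 / 2) (Set.Icc a t) :=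
    antitoneOn_of_hasDerivWithinAt_nonpos (convex_Icc a t)
      (fun s hs ↦ ((hf s hs).add (hq s)).continuousWithinAt)
      (fun s hs ↦ ((hf s (interior_subset hs)).add (hq s)).mono interior_subset)
      (fun s hs ↦ by linarith [(abs_le.1 (hd s (interior_subset hs))).2])
  have h₁ := hmono hτ ht hτ.2
  have h₂ := hanti hτ ht hτ.2
  simp only [sub_self] at h₁ h₂
  rw [abs_le]
  constructor <;> linarith

/-- A `3 × 3` real matrix whose entries are within `1/8` of those of the identity has determinant
within `1/2` of `1`. -/
theorem abs_det_sub_one_le_half {A : Matrix (Fin 3) (Fin 3) ℝ}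
    (hA : ∀ i j, |A i j - (1 : Matrix (Fin 3) (Fin 3) ℝ) i j| ≤ 1 / 8) :
    |A.det - 1| ≤ 1 / 2 := by
  obtain ⟨E, rfl⟩ : ∃ E, A = 1 + E := ⟨A - 1, by abel⟩
  simp only [Matrix.add_apply, add_sub_cancel_left] at hA
  have h2 : ∀ i j k l, |E i j * E k l| ≤ 1 / 64 := fun i j k l ↦ by
    rw [abs_mul]
    exact (mul_le_mul (hA i j) (hA k l) (abs_nonneg _) (by norm_num)).trans (by norm_num)
  have h3 : ∀ i j k l m n, |E i j * E k l * E m n| ≤ 1 / 512 := fun i j k l m n ↦ by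
    rw [abs_mul]
    exact (mul_le_mul (h2 i j k l) (hA m n) (abs_nonneg _) (by norm_num)).trans (by norm_num)
  simp only [abs_le] at hA h2 h3 ⊢
  simp only [Matrix.det_fin_three, Matrix.add_apply, Matrix.one_apply]
  norm_num [Fin.ext_iff]
  constructor <;>
  linarith [hA 0 0, hA 1 1, hA 2 2, h2 0 0 1 1, h2 0 0 2 2, h2 1 1 2 2, h2 0 1 1 0, h2 0 2 2 0,
    h2 1 2 2 1, h3 0 0 1 1 2 2, h3 0 0 1 2 2 1, h3 0 1 1 0 2 2, h3 0 1 1 2 2 0, h3 0 2 1 0 2 1,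
    h3 0 2 1 1 2 0]

/-- Jacobian estimate for the spatial derivative of the characteristic flow: if
`Z(t) = I`, `Z'(t) = 0` and `|Z''| ≤ K` entrywise on `[t - T₀, t]` with `K T₀² ≤ 1/4`,
then `1/2 ≤ |det Z(τ)| ≤ 2` on this interval. -/
theorem stmt12 (t T₀ K : ℝ) (hT₀ : 0 < T₀) (hK : 0 ≤ K) (hKT : K * T₀ ^ 2 ≤ 1/4)
    (Z Z' Z'' : ℝ → Matrix (Fin 3) (Fin 3) ℝ)
    (hZ : ∀ i j : Fin 3, ∀ s ∈ Set.Icc (t - T₀) t,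
      HasDerivWithinAt (fun r => Z r i j) (Z' s i j) (Set.Icc (t - T₀) t) s)
    (hZ' : ∀ i j : Fin 3, ∀ s ∈ Set.Icc (t - T₀) t,
      HasDerivWithinAt (fun r => Z' r i j) (Z'' s i j) (Set.Icc (t - T₀) t) s)
    (hZ''cont : ∀ i j : Fin 3, ContinuousOn (fun s => Z'' s i j) (Set.Icc (t - T₀) t))
    (hZt : Z t = 1) (hZ't : Z' t = 0)
    (hZ''bd : ∀ i j : Fin 3, ∀ s ∈ Set.Icc (t - T₀) t, |Z'' s i j| ≤ K) :
    ∀ τ ∈ Set.Icc (t - T₀) t,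
      1/2 ≤ |(Z τ).det| ∧ |(Z τ).det| ≤ 2 := by
  intro τ hτ
  have hdet : |(Z τ).det - 1| ≤ 1 / 2 := abs_det_sub_one_le_half fun i j ↦ by
    have h := abs_sub_le_of_second_deriv_bound (hZ i j) (hZ' i j) (by simp [hZ't])
      (hZ''bd i j) hτ
    rw [hZt] at h
    have hsq : (t - τ) ^ 2 ≤ T₀ ^ 2 :=
      pow_le_pow_left₀ (sub_nonneg.2 hτ.2) (by linarith [hτ.1]) 2
    linarith [mul_le_mul_of_nonneg_left hsq hK]
  obtain ⟨h₁, h₂⟩ := abs_le.1 hdet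
  rw [abs_of_pos (by linarith)]
  constructor <;> linarith
end
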